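/- Let δ > 0, let x̂ and x be real numbers with |x - x̂| ≤ δ, let ε be a real number with 0 < ε ≤ δ, and let N be a natural number with 2^N ≥ 4δ²/ε. Then exp(x - ε) ≤ exp(x̂)·(1 + 2^{-N}·(x - x̂))^{2^N} ≤ exp(x). -/

import Mathlib

theorem Real.exp_sub_two_mul_sq_le_one_add {t : ℝ} (ht : -(1 / 2) ≤ t) :
    Real.exp (t - 2 * t ^ 2) ≤ 1 + t := by
  have h : 1 - t + 2 * t ^ 2 ≤ Real.exp (-(t - 2 * t ^ 2)) := by
    linarith [Real.add_one_le_exp (-(t - 2 * t ^ 2))]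
  have hpoly : 1 ≤ (1 + t) * (1 - t + 2 * t ^ 2) := by
    nlinarith [mul_nonneg (sq_nonneg t) (by linarith : 0 ≤ 1 + 2 * t)]
  calc Real.exp (t - 2 * t ^ 2)
      ≤ Real.exp (t - 2 * t ^ 2) * ((1 + t) * Real.exp (-(t - 2 * t ^ 2))) :=
        le_mul_of_one_le_right (Real.exp_pos _).le
          (hpoly.trans (mul_le_mul_of_nonneg_left h (by linarith)))
    _ = 1 + t := by
        rw [mul_left_comm, ← Real.exp_add, add_neg_cancel, Real.exp_zero, mul_one]

/-- Proposition 3.5 (shifting method): for `δ > 0`, `|x - x̂| ≤ δ`, `0 < ε ≤ δ` and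
`N` with `2^N ≥ 4δ²/ε`, `exp(x - ε) ≤ exp(x̂)(1 + 2^{-N}(x - x̂))^{2^N} ≤ exp(x)`. -/
theorem exp_shift_approx (δ xhat x ε : ℝ) (N : ℕ) (hδ : 0 < δ) (hx : |x - xhat| ≤ δ)
    (hε : 0 < ε) (hεδ : ε ≤ δ) (hN : 4 * δ ^ 2 / ε ≤ (2 : ℝ) ^ N) :
    Real.exp (x - ε) ≤ Real.exp xhat * (1 + (2 : ℝ) ^ (-(N : ℤ)) * (x - xhat)) ^ (2 ^ N) ∧
      Real.exp xhat * (1 + (2 : ℝ) ^ (-(N : ℤ)) * (x - xhat)) ^ (2 ^ N) ≤ Real.exp x := by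
  have hM : (0 : ℝ) < 2 ^ N := by positivity
  rw [div_le_iff₀ hε] at hN
  obtain ⟨t, ht⟩ : ∃ t, t = (2 : ℝ) ^ (-(N : ℤ)) * (x - xhat) := ⟨_, rfl⟩
  have hMt : 2 ^ N * t = x - xhat := by
    rw [ht, zpow_neg, zpow_natCast, mul_inv_cancel_left₀ hM.ne']
  rw [← ht]
  have hδM : 4 * δ ≤ 2 ^ N := by
    have : 2 ^ N * ε ≤ 2 ^ N * δ := mul_le_mul_of_nonneg_left hεδ hM.le
    exact le_of_mul_le_mul_right (by linarith [sq δ] : 4 * δ * δ ≤ 2 ^ N * δ) hδ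
  have ht_lower : -(1 / 4) ≤ t :=
    le_of_mul_le_mul_left (by linarith [(abs_le.mp hx).1]) hM
  have ht_sq : 2 ^ N * (2 * t ^ 2) ≤ ε := by
    have hsq : (2 ^ N * t) ^ 2 ≤ δ ^ 2 := by
      rw [hMt]
      exact sq_le_sq' (abs_le.mp hx).1 (abs_le.mp hx).2
    refine le_of_mul_le_mul_left (a := (2 : ℝ) ^ N) ?_ hM
    linarith [sq_nonneg δ, mul_pow ((2 : ℝ) ^ N) t 2,
      (by ring : (2 : ℝ) ^ N * (2 ^ N * (2 * t ^ 2)) = 2 * (2 ^ N * t) ^ 2)]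
  have hexp (s : ℝ) : Real.exp s ^ (2 ^ N) = Real.exp (2 ^ N * s) := by
    rw [← Real.exp_nat_mul]
    push_cast
    rfl
  constructor
  · calc Real.exp (x - ε) ≤ Real.exp (xhat + 2 ^ N * (t - 2 * t ^ 2)) :=
          Real.exp_le_exp.mpr (by rw [mul_sub]; linarith)
      _ = Real.exp xhat * Real.exp (t - 2 * t ^ 2) ^ (2 ^ N) := by rw [Real.exp_add, hexp]
      _ ≤ Real.exp xhat * (1 + t) ^ (2 ^ N) := by
          gcongr
          exact Real.exp_sub_two_mul_sq_le_one_add (by linarith)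
  · calc Real.exp xhat * (1 + t) ^ (2 ^ N) ≤ Real.exp xhat * Real.exp t ^ (2 ^ N) := by
          gcongr
          · linarith
          · linarith [Real.add_one_le_exp t]
      _ = Real.exp x := by rw [hexp, hMt, ← Real.exp_add, add_sub_cancel]
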